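/- arXiv:1907.05394 — 2 statements merged into one kernel-verified Lean document; each statement's English description precedes it below -/
import Mathlib

section
/- Suppose given simplicial sets X_k and Y_k for k ∈ ℕ, maps p_k : X_k → Y_k, and monomorphisms X_k → X_{k+1} and Y_k → Y_{k+1} making all the squares from p_k to p_{k+1} commute. If every p_k is a Kan fibration, then the induced map colim_k X_k → colim_k Y_k on sequential colimits is a Kan fibration; likewise, if every p_k is a trivial fibration, then colim_k X_k → colim_k Y_k is a trivial fibration. -/
open CategoryTheory CategoryTheory.Limits Simplicial MonoidalCategory SSet

noncomputable instance : MonoidalClosed SSet.{0} :=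
  (inferInstance : MonoidalClosed (SimplexCategoryᵒᵖ ⥤ Type 0))

namespace Paper

/-- A map of simplicial sets is a *trivial fibration* if it has the right lifting
property with respect to all boundary inclusions `∂Δ[n] ⟶ Δ[n]` for `n ≥ 0`. -/
def TrivialFibration {X Y : SSet.{0}} (p : X ⟶ Y) : Prop :=
  ∀ n : ℕ, HasLiftingProperty (SSet.boundary n).ι p

/-- A map of simplicial sets is a *Kan fibration* if it has the right lifting property
with respect to all horn inclusions `Λ[n, i] ⟶ Δ[n]` for `n ≥ 1`, `0 ≤ i ≤ n`. -/
def KanFibration {X Y : SSet.{0}} (p : X ⟶ Y) : Prop :=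
  ∀ (n : ℕ) (i : Fin (n + 2)), HasLiftingProperty (SSet.horn (n + 1) i).ι p

/-- An *anodyne* map is one with the left lifting property with respect to
all Kan fibrations. -/
def Anodyne {A B : SSet.{0}} (i : A ⟶ B) : Prop :=
  ∀ ⦃X Y : SSet.{0}⦄ (p : X ⟶ Y), KanFibration p → HasLiftingProperty i p

/-- The unique map to `Δ[0]`. -/
def toPt (X : SSet.{0}) : X ⟶ Δ[0] where
  app m := ↾fun _ => SSet.stdSimplex.const 0 0 m
  naturality := by
    intro m m' φ
    ext x
    apply stdSimplex.objEquiv.injective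
    apply SimplexCategory.Hom.ext
    apply OrderHom.ext
    funext j
    exact @Subsingleton.elim (Fin 1) _ _ _

/-- A *Kan complex* is a simplicial set whose map to `Δ[0]` is a Kan fibration. -/
def KanComplex (X : SSet.{0}) : Prop :=
  KanFibration (toPt X)

/-- The constant map at the vertex `k` of `Δ[1]`. -/
def cst (X : SSet.{0}) (k : Fin 2) : X ⟶ Δ[1] where
  app m := ↾fun _ => SSet.stdSimplex.const 1 k m
  naturality := by
    intro m m' φ
    ext x
    apply stdSimplex.objEquiv.injective
    apply SimplexCategory.Hom.ext
    ext j
    rfl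

/-- The endpoint inclusion `X ⟶ X ⊗ Δ[1]` at the vertex `k` of `Δ[1]`. -/
noncomputable def ept (X : SSet.{0}) (k : Fin 2) : X ⟶ X ⊗ Δ[1] :=
  CartesianMonoidalCategory.lift (𝟙 X) (cst X k)

/-- A (single-step) homotopy from `f` to `g`, as a property of the pair `(f, g)`. -/
def Homotopy {X Y : SSet.{0}} (f g : X ⟶ Y) : Prop :=
  ∃ H : X ⊗ Δ[1] ⟶ Y, ept X 0 ≫ H = f ∧ ept X 1 ≫ H = g

/-- `f` and `g` are *homotopic* if they are connected by a zig-zag of homotopies. -/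
def Homotopic {X Y : SSet.{0}} (f g : X ⟶ Y) : Prop :=
  Relation.EqvGen Homotopy f g

/-- A *homotopy equivalence* of simplicial sets. -/
def HomotopyEquivalence {X Y : SSet.{0}} (f : X ⟶ Y) : Prop :=
  ∃ g : Y ⟶ X, Homotopic (f ≫ g) (𝟙 X) ∧ Homotopic (g ≫ f) (𝟙 Y)

/-- A map `f : X ⟶ Y` is a *weak homotopy equivalence* if for every Kan complex `K`
the induced map `K^Y ⟶ K^X` on exponentials is a homotopy equivalence. -/
def WeakHomotopyEquivalence {X Y : SSet.{0}} (f : X ⟶ Y) : Prop :=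
  ∀ K : SSet.{0}, KanComplex K → HomotopyEquivalence ((MonoidalClosed.pre f).app K)

/-- A homotopy `H` between maps over `B` which is *fiberwise over `B`*. -/
def FibHomotopy {B X Y : SSet.{0}} (pX : X ⟶ B) (pY : Y ⟶ B) (f g : X ⟶ Y) : Prop :=
  ∃ H : X ⊗ Δ[1] ⟶ Y, ept X 0 ≫ H = f ∧ ept X 1 ≫ H = g ∧
    H ≫ pY = SemiCartesianMonoidalCategory.fst X Δ[1] ≫ pX

/-- Connectedness by a zig-zag of fiberwise homotopies over `B`. -/
def FibHomotopic {B X Y : SSet.{0}} (pX : X ⟶ B) (pY : Y ⟶ B) (f g : X ⟶ Y) : Prop :=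
  Relation.EqvGen (FibHomotopy pX pY) f g

/-- A *fiberwise homotopy equivalence over `B`*. -/
def FibHomotopyEquivalence {B X Y : SSet.{0}} (pX : X ⟶ B) (pY : Y ⟶ B) (f : X ⟶ Y) : Prop :=
  f ≫ pY = pX ∧ ∃ g : Y ⟶ X, g ≫ pX = pY ∧
    FibHomotopic pX pX (f ≫ g) (𝟙 X) ∧ FibHomotopic pY pY (g ≫ f) (𝟙 Y)

end Paper


/-- A morphism between finitely presentable objects which has the left lifting property with
respect to each component of a natural transformation between filtered diagrams also has it
with respect to the induced map on colimits. -/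
theorem hasLiftingProperty_colimMap_of_isFinitelyPresentable {C : Type*} [Category* C]
    {J : Type} [SmallCategory J] [IsFiltered J] {F G : J ⥤ C} [HasColimit F] [HasColimit G]
    (p : F ⟶ G) {A B : C} (i : A ⟶ B)
    [IsFinitelyPresentable.{0} A] [IsFinitelyPresentable.{0} B]
    (h : ∀ j, HasLiftingProperty i (p.app j)) : HasLiftingProperty i (colimMap p) where
  sq_hasLift {f g} sq := by
    obtain ⟨j₁, f', rfl⟩ := IsFinitelyPresentable.exists_hom_of_isColimit (colimit.isColimit F) f
    obtain ⟨j₂, g', rfl⟩ := IsFinitelyPresentable.exists_hom_of_isColimit (colimit.isColimit G) g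
    obtain ⟨k, u, v, huv⟩ := IsFinitelyPresentable.exists_eq_of_isColimit (colimit.isColimit G)
      (f' ≫ p.app j₁) (i ≫ g') (by simpa using sq.w)
    have sq' : CommSq (f' ≫ F.map u) i (p.app k) (g' ≫ G.map v) := ⟨by simpa using huv⟩
    have := h k
    exact ⟨⟨{
      l := sq'.lift ≫ colimit.ι F k
      fac_left := by simp
      fac_right := by simp [sq'.fac_right_assoc] }⟩⟩

/-- Sequential colimits of (trivial) fibrations along levelwise
monomorphisms are (trivial) fibrations. -/
theorem colimit_fibration {X Y : ℕ ⥤ SSet.{0}} (p : X ⟶ Y)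
    (hX : ∀ k : ℕ, Mono (X.map (homOfLE (Nat.le_succ k))))
    (hY : ∀ k : ℕ, Mono (Y.map (homOfLE (Nat.le_succ k)))) :
    ((∀ k : ℕ, Paper.KanFibration (p.app k)) → Paper.KanFibration (colimMap p)) ∧
    ((∀ k : ℕ, Paper.TrivialFibration (p.app k)) → Paper.TrivialFibration (colimMap p)) := by
  exact ⟨fun h n i ↦ hasLiftingProperty_colimMap_of_isFinitelyPresentable p _ fun k ↦ h k n i,
    fun h n ↦ hasLiftingProperty_colimMap_of_isFinitelyPresentable p _ fun k ↦ h k n⟩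
end

section
/- (Equivalence extension property) Let i : A → B be a monomorphism of simplicial sets, let q₁ : Y₁ → B be a Kan fibration, let X₁ = A ×_B Y₁ with its projection to A, let p₀ : X₀ → A be a Kan fibration, and let w : X₀ → X₁ be a map over A that is a fiberwise homotopy equivalence over A. Then there exist a Kan fibration q₀ : Y₀ → B and a map v : Y₀ → Y₁ over B that is a fiberwise homotopy equivalence over B, together with an isomorphism X₀ ≅ A ×_B Y₀ over A under which w is identified with the map A ×_B Y₀ → A ×_B Y₁ = X₁ induced by v. -/
open CategoryTheory CategoryTheory.Limits Simplicial MonoidalCategory SSet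

namespace Paper

theorem exists_hom_of_rel {X Y : SSet.{0}} (R : ∀ n, X.obj n → Y.obj n → Prop)
    (total : ∀ n x, ∃ y, R n x y)
    (unique : ∀ n x y y', R n x y → R n x y' → y = y')
    (natural : ∀ n m (φ : n ⟶ m) x y, R n x y → R m (X.map φ x) (Y.map φ y)) :
    ∃ f : X ⟶ Y, ∀ n x y, R n x y ↔ f.app n x = y := by
  choose f hf using total
  refine ⟨{ app n := ↾(f n), naturality := ?_ },
    fun n x y => ⟨fun h => unique _ _ _ _ (hf n x) h, fun h => h ▸ hf n x⟩⟩
  intro n m φ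
  ext x
  exact unique _ _ _ _ (hf _ _) (natural _ _ φ _ _ (hf _ _))

theorem app_congr {X Y : SSet.{0}} {f g : X ⟶ Y} (h : f = g) {n} (x : X.obj n) :
    f.app n x = g.app n x := by rw [h]

theorem app_injective {X Y : SSet.{0}} (f : X ⟶ Y) [Mono f] (n) :
    Function.Injective (f.app n) :=
  (mono_iff_injective (f.app n)).1 inferInstance

theorem map_app {X Y : SSet.{0}} (f : X ⟶ Y) {n m} (φ : n ⟶ m) (x : X.obj n) :
    Y.map φ (f.app n x) = f.app m (X.map φ x) :=
  (NatTrans.naturality_apply f φ x).symm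

theorem const_zero_ne_const_one (n : SimplexCategoryᵒᵖ) :
    (stdSimplex.const 1 0 n : (Δ[1] : SSet.{0}).obj n) ≠ stdSimplex.const 1 1 n := by
  intro h
  have := congr_arg (fun s => stdSimplex.asOrderHom s 0) h
  exact absurd this (show ¬ ((0 : Fin 2) = 1) by decide)

theorem mem_horn_one_iff (e : Fin 2) {n : SimplexCategoryᵒᵖ} (t : (Δ[1] : SSet.{0}).obj n) :
    t ∈ (SSet.horn 1 e).obj n ↔ t = stdSimplex.const 1 e n := by
  have key : t ∈ (SSet.horn 1 e).obj n ↔ ∀ k, stdSimplex.asOrderHom t k = e := by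
    change Set.range (stdSimplex.asOrderHom t) ∪ {e} ≠ Set.univ ↔ _
    rw [Set.ne_univ_iff_exists_notMem]
    constructor
    · rintro ⟨a, ha⟩ k
      simp only [Set.union_singleton, Set.mem_insert_iff, Set.mem_range, not_or, not_exists] at ha
      have := ha.2 k
      omega
    · intro h
      refine ⟨1 - e, ?_⟩
      simp only [Set.union_singleton, Set.mem_insert_iff, Set.mem_range, not_or, not_exists, h]
      clear h
      revert e
      simp only [forall_const]
      decide
  rw [key]
  constructor
  · intro h
    apply stdSimplex.objEquiv.injective
    apply SimplexCategory.Hom.ext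
    ext1
    funext k
    exact h k
  · rintro rfl k
    rfl

theorem KanFibration.rlp_J {X Y : SSet.{0}} {p : X ⟶ Y} (hp : KanFibration p) :
    (modelCategoryQuillen.J).rlp p := by
  intro _ _ _ h
  simp only [modelCategoryQuillen.J, MorphismProperty.iSup_iff] at h
  obtain ⟨n, ⟨i⟩⟩ := h
  exact hp n i

/-- The homotopy lifting property of a Kan fibration, relative to a union of two subobjects. -/
theorem KanFibration.exists_homotopy_lift {E A L P Q : SSet.{0}} {p : E ⟶ A}
    (hp : KanFibration p) (e : Fin 2) (i : P ⟶ L) (j : Q ⟶ L) [Mono i] [Mono j]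
    (u : P ⊗ Δ[1] ⟶ E) (v : Q ⊗ Δ[1] ⟶ E) (f : L ⟶ E) (b : L ⊗ Δ[1] ⟶ A)
    (huv : ∀ n x y (t : (Δ[1] : SSet.{0}).obj n), i.app n x = j.app n y →
      u.app n (x, t) = v.app n (y, t))
    (hu : ept P e ≫ u = i ≫ f) (hv : ept Q e ≫ v = j ≫ f)
    (hub : u ≫ p = i ▷ Δ[1] ≫ b) (hvb : v ≫ p = j ▷ Δ[1] ≫ b)
    (hfb : f ≫ p = ept L e ≫ b) :
    ∃ H : L ⊗ Δ[1] ⟶ E, ept L e ≫ H = f ∧ i ▷ Δ[1] ≫ H = u ∧ j ▷ Δ[1] ≫ H = v ∧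
      H ≫ p = b := by
  let U := (Subcomplex.range i ⊔ Subcomplex.range j).unionProd (SSet.horn 1 e)
  let R : ∀ n, (U : SSet).obj n → E.obj n → Prop := fun n z y =>
    (∃ l, (l, stdSimplex.const 1 e n) = z.1 ∧ f.app n l = y) ∨
    (∃ x t, (i.app n x, t) = z.1 ∧ u.app n (x, t) = y) ∨
    (∃ x t, (j.app n x, t) = z.1 ∧ v.app n (x, t) = y)
  obtain ⟨g, hg⟩ := exists_hom_of_rel R (by
      rintro n ⟨⟨l, t⟩, hz⟩
      obtain h | ⟨x, rfl⟩ | ⟨x, rfl⟩ := (Subcomplex.mem_unionProd_iff _ _ _).1 hz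
      · exact ⟨_, Or.inl ⟨l, Prod.ext rfl ((mem_horn_one_iff e t).1 h).symm, rfl⟩⟩
      · exact ⟨_, Or.inr (Or.inl ⟨x, t, rfl, rfl⟩)⟩
      · exact ⟨_, Or.inr (Or.inr ⟨x, t, rfl, rfl⟩)⟩)
    (by
      rintro n ⟨z, hz⟩ y y' h h'
      have hu' := fun x => app_congr hu (n := n) x
      have hv' := fun x => app_congr hv (n := n) x
      obtain ⟨l, rfl, rfl⟩ | ⟨x, t, rfl, rfl⟩ | ⟨x, t, rfl, rfl⟩ := h <;>
      obtain ⟨l', h', rfl⟩ | ⟨x', t', h', rfl⟩ | ⟨x', t', h', rfl⟩ := h' <;>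
      obtain ⟨h1, h2⟩ := Prod.ext_iff.1 h' <;> dsimp only at h1 h2
      · rw [h1]
      · subst h1 h2; exact (hu' x').symm
      · subst h1 h2; exact (hv' x').symm
      · subst h1 h2; exact hu' x
      · subst h2; rw [app_injective _ _ h1]
      · subst h2; exact huv _ _ _ _ h1.symm
      · subst h1 h2; exact hv' x
      · subst h2; exact (huv _ _ _ _ h1).symm
      · subst h2; rw [app_injective _ _ h1])
    (by
      rintro n m φ ⟨z, hz⟩ y h
      obtain ⟨l, rfl, rfl⟩ | ⟨x, t, rfl, rfl⟩ | ⟨x, t, rfl, rfl⟩ := h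
      · exact Or.inl ⟨L.map φ l, rfl, (map_app f φ l).symm⟩
      · refine Or.inr (Or.inl ⟨P.map φ x, (Δ[1] : SSet.{0}).map φ t, ?_, (map_app u φ (x, t)).symm⟩)
        rw [← map_app]; rfl
      · refine Or.inr (Or.inr ⟨Q.map φ x, (Δ[1] : SSet.{0}).map φ t, ?_, (map_app v φ (x, t)).symm⟩)
        rw [← map_app]; rfl)
  have hl : HasLiftingProperty U.ι p :=
    anodyneExtensions_unionProd_ι _ _ (anodyneExtensions.horn_ι e) _ hp.rlp_J
  have sq : CommSq g U.ι p b := ⟨by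
    ext n ⟨z, hz⟩
    obtain ⟨l, h, h'⟩ | ⟨x, t, h, h'⟩ | ⟨x, t, h, h'⟩ := (hg n ⟨z, hz⟩ _).2 rfl <;>
      dsimp only at h <;> subst h <;> change p.app n (g.app n _) = _ <;> rw [← h']
    · exact app_congr hfb l
    · exact app_congr hub (x, t)
    · exact app_congr hvb (x, t)⟩
  have hl : ∀ n z hz y, R n ⟨z, hz⟩ y → sq.lift.app n z = y := fun n z hz y h =>
    (app_congr sq.fac_left (⟨z, hz⟩ : U.obj n)).trans ((hg n _ y).1 h)
  refine ⟨sq.lift, ?_, ?_, ?_, sq.fac_right⟩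
  · ext n x
    exact hl n _ (Or.inl ⟨trivial, (mem_horn_one_iff e _).2 rfl⟩) _ (Or.inl ⟨x, rfl, rfl⟩)
  · ext n ⟨x, t⟩
    exact hl n _ (Or.inr ⟨Or.inl ⟨x, rfl⟩, trivial⟩) _ (Or.inr (Or.inl ⟨x, t, rfl, rfl⟩))
  · ext n ⟨x, t⟩
    exact hl n _ (Or.inr ⟨Or.inr ⟨x, rfl⟩, trivial⟩) _ (Or.inr (Or.inr ⟨x, t, rfl, rfl⟩))

theorem ept_fst (X : SSet.{0}) (e : Fin 2) :
    ept X e ≫ SemiCartesianMonoidalCategory.fst X Δ[1] = 𝟙 X := rfl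

theorem ept_fst_comp {X Y : SSet.{0}} (e : Fin 2) (f : X ⟶ Y) :
    ept X e ≫ SemiCartesianMonoidalCategory.fst X Δ[1] ≫ f = f := rfl

theorem ept_whiskerRight_comp {X Y Z : SSet.{0}} (e : Fin 2) (f : X ⟶ Y) (g : Y ⊗ Δ[1] ⟶ Z) :
    ept X e ≫ f ▷ Δ[1] ≫ g = f ≫ ept Y e ≫ g := rfl

theorem whiskerRight_fst_comp {X Y Z : SSet.{0}} (f : X ⟶ Y) (g : Y ⟶ Z) :
    f ▷ Δ[1] ≫ SemiCartesianMonoidalCategory.fst Y Δ[1] ≫ g =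
      SemiCartesianMonoidalCategory.fst X Δ[1] ≫ f ≫ g := rfl

/-- Two fiberwise homotopies with the same target, agreeing on a subobject, can be composed to a
fiberwise homotopy between their sources which is constant on this subobject. -/
theorem KanFibration.exists_homotopy_of_common_target {E A K X : SSet.{0}} {p : E ⟶ A}
    (hp : KanFibration p) (k : X ⟶ K) [Mono k] (β : K ⟶ A) (a b : K ⊗ Δ[1] ⟶ E)
    (ha : a ≫ p = SemiCartesianMonoidalCategory.fst K Δ[1] ≫ β)
    (hb : b ≫ p = SemiCartesianMonoidalCategory.fst K Δ[1] ≫ β)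
    (hab : ept K 1 ≫ a = ept K 1 ≫ b) (hk : k ▷ Δ[1] ≫ a = k ▷ Δ[1] ≫ b) :
    ∃ c : K ⊗ Δ[1] ⟶ E, ept K 0 ≫ c = ept K 0 ≫ a ∧ ept K 1 ≫ c = ept K 0 ≫ b ∧
      c ≫ p = SemiCartesianMonoidalCategory.fst K Δ[1] ≫ β ∧
      k ▷ Δ[1] ≫ c = SemiCartesianMonoidalCategory.fst X Δ[1] ≫ k ≫ ept K 0 ≫ a := by
  let Q : (K ⊗ Δ[1]).Subcomplex := Subcomplex.range (ept K 1) ⊔ Subcomplex.range (k ▷ Δ[1])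
  have : Mono (ept K 0) :=
    mono_of_mono_fac (ept_fst K 0)
  obtain ⟨H, hH, hHa, hHb, hHp⟩ := hp.exists_homotopy_lift 1 (ept K 0) Q.ι a
    ((Q.ι ≫ SemiCartesianMonoidalCategory.fst K Δ[1]) ▷ Δ[1] ≫ b)
    (SemiCartesianMonoidalCategory.fst K Δ[1] ≫ ept K 1 ≫ a)
    (SemiCartesianMonoidalCategory.fst _ Δ[1] ≫ SemiCartesianMonoidalCategory.fst K Δ[1] ≫ β)
    (by
      rintro n x ⟨y, hy⟩ t (rfl : _ = y)
      obtain ⟨x', h⟩ | ⟨⟨x', s⟩, h⟩ := hy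
      · exact absurd (congr_arg Prod.snd h).symm (const_zero_ne_const_one n)
      · obtain rfl : k.app n x' = x := congr_arg Prod.fst h
        exact app_congr hk (x', t))
    (by rw [ept_fst_comp])
    (by
      ext n x
      exact (app_congr hab x.1.1).symm)
    (by rw [whiskerRight_fst_comp, ept_fst_comp, ha])
    (by
      ext n ⟨x, t⟩
      exact app_congr hb (x.1.1, t))
    (by
      ext n ⟨x, s⟩
      exact app_congr ha (x, stdSimplex.const 1 1 n))
  refine ⟨ept _ 0 ≫ H, ?_, ?_, ?_, ?_⟩
  · ext n x
    exact app_congr hHa (x, stdSimplex.const 1 0 n)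
  · ext n x
    exact app_congr hHb
      ((⟨(x, stdSimplex.const 1 1 n), Or.inl ⟨x, rfl⟩⟩ : Q.obj n), stdSimplex.const 1 0 n)
  · rw [Category.assoc, hHp, ept_fst_comp]
  · ext n ⟨x, s⟩
    exact (app_congr hHb ((⟨(k.app n x, s), Or.inr ⟨(x, s), rfl⟩⟩ : Q.obj n),
      stdSimplex.const 1 0 n)).trans (app_congr hk (x, stdSimplex.const 1 0 n)).symm

section FibHomotopy

variable {A X Y Z : SSet.{0}} {pX : X ⟶ A} {pY : Y ⟶ A} {pZ : Z ⟶ A}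

theorem FibHomotopy.of_common_target (hp : KanFibration pY) {f g h : X ⟶ Y}
    (hf : FibHomotopy pX pY f h) (hg : FibHomotopy pX pY g h) : FibHomotopy pX pY f g := by
  obtain ⟨a, ha₀, ha₁, ha⟩ := hf
  obtain ⟨b, hb₀, hb₁, hb⟩ := hg
  obtain ⟨c, hc₀, hc₁, hc, -⟩ := hp.exists_homotopy_of_common_target (⊥ : X.Subcomplex).ι pX a b
    ha hb (by rw [ha₁, hb₁]) (by ext n ⟨⟨x, hx⟩, t⟩; exact hx.elim)
  exact ⟨c, by rw [hc₀, ha₀], by rw [hc₁, hb₀], hc⟩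

theorem FibHomotopy.refl {f : X ⟶ Y} (hf : f ≫ pY = pX) : FibHomotopy pX pY f f :=
  ⟨SemiCartesianMonoidalCategory.fst X Δ[1] ≫ f, rfl, rfl, by rw [Category.assoc, hf]⟩

theorem FibHomotopy.right_comp {f g : X ⟶ Y} (h : FibHomotopy pX pY f g) : g ≫ pY = pX := by
  obtain ⟨H, -, rfl, h⟩ := h
  rw [Category.assoc, h]
  rfl

theorem FibHomotopy.symm (hp : KanFibration pY) {f g : X ⟶ Y}
    (h : FibHomotopy pX pY f g) : FibHomotopy pX pY g f :=
  .of_common_target hp (.refl h.right_comp) h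

theorem FibHomotopy.trans (hp : KanFibration pY) {f g h : X ⟶ Y}
    (hfg : FibHomotopy pX pY f g) (hgh : FibHomotopy pX pY g h) : FibHomotopy pX pY f h :=
  .of_common_target hp hfg (hgh.symm hp)

theorem FibHomotopic.fibHomotopy (hp : KanFibration pY) {f g : X ⟶ Y} (hg : g ≫ pY = pX)
    (h : FibHomotopic pX pY f g) : FibHomotopy pX pY f g := by
  have key : f = g ∨ FibHomotopy pX pY f g := by
    clear hg
    induction h with
    | rel f g h => exact Or.inr h
    | refl f => exact Or.inl rfl
    | symm f g _ h => exact h.imp Eq.symm (FibHomotopy.symm hp)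
    | trans f g h _ _ h₁ h₂ =>
      obtain rfl | h₁ := h₁
      · exact h₂
      · obtain rfl | h₂ := h₂
        · exact Or.inr h₁
        · exact Or.inr (h₁.trans hp h₂)
  obtain rfl | h := key
  · exact .refl hg
  · exact h

theorem FibHomotopic.comp_right {f g : X ⟶ Y} (h : FibHomotopic pX pY f g) (k : Y ⟶ Z)
    (hk : k ≫ pZ = pY) : FibHomotopic pX pZ (f ≫ k) (g ≫ k) := by
  induction h with
  | rel f g h =>
    obtain ⟨H, rfl, rfl, h⟩ := h
    exact .rel _ _ ⟨H ≫ k, by simp, by simp, by rw [Category.assoc, hk, h]⟩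
  | refl f => exact .refl _
  | symm f g _ h => exact .symm _ _ h
  | trans f g h _ _ h₁ h₂ => exact .trans _ _ _ h₁ h₂

theorem FibHomotopic.comp_left {f g : Y ⟶ Z} (h : FibHomotopic pY pZ f g) (k : X ⟶ Y)
    (hk : k ≫ pY = pX) : FibHomotopic pX pZ (k ≫ f) (k ≫ g) := by
  induction h with
  | rel f g h =>
    obtain ⟨H, rfl, rfl, h⟩ := h
    exact .rel _ _ ⟨k ▷ Δ[1] ≫ H, rfl, rfl, by rw [Category.assoc, h, ← hk]; rfl⟩
  | refl f => exact .refl _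
  | symm f g _ h => exact .symm _ _ h
  | trans f g h _ _ h₁ h₂ => exact .trans _ _ _ h₁ h₂

theorem FibHomotopyEquivalence.comp {f : X ⟶ Y} {g : Y ⟶ Z}
    (hf : FibHomotopyEquivalence pX pY f) (hg : FibHomotopyEquivalence pY pZ g) :
    FibHomotopyEquivalence pX pZ (f ≫ g) := by
  obtain ⟨hf, f', hf', h₁, h₂⟩ := hf
  obtain ⟨hg, g', hg', h₃, h₄⟩ := hg
  refine ⟨by rw [Category.assoc, hg, hf], g' ≫ f', by rw [Category.assoc, hf', hg'], ?_, ?_⟩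
  · refine .trans _ (f ≫ f') _ ?_ h₁
    have := (h₃.comp_left f hf).comp_right f' hf'
    simpa [FibHomotopic] using this
  · refine .trans _ (g' ≫ g) _ ?_ h₄
    have := (h₂.comp_left g' hg').comp_right g hg
    simpa [FibHomotopic] using this

/-- A monomorphism between fibrant objects over `A` which is a fiberwise homotopy equivalence is
a strong deformation retract over `A`. -/
theorem FibHomotopyEquivalence.exists_strong_deformation_retraction
    (hpX : KanFibration pX) (hpY : KanFibration pY) {j : X ⟶ Y} [Mono j]
    (hj : FibHomotopyEquivalence pX pY j) :
    ∃ (r : Y ⟶ X) (H : Y ⊗ Δ[1] ⟶ Y), j ≫ r = 𝟙 X ∧ ept Y 0 ≫ H = 𝟙 Y ∧ ept Y 1 ≫ H = r ≫ j ∧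
      H ≫ pY = SemiCartesianMonoidalCategory.fst Y Δ[1] ≫ pY ∧
      j ▷ Δ[1] ≫ H = SemiCartesianMonoidalCategory.fst X Δ[1] ≫ j := by
  obtain ⟨hj, g, hg, h₁, h₂⟩ := hj
  obtain ⟨G, hG₀, hG₁, hG⟩ := h₁.fibHomotopy hpX (Category.id_comp _)
  obtain ⟨R, hR₀, hRG, -, hR⟩ := hpX.exists_homotopy_lift 0 j j G G g
    (SemiCartesianMonoidalCategory.fst Y Δ[1] ≫ pY)
    (by
      intro n x y t h
      rw [app_injective _ _ h])
    hG₀ hG₀ (by rw [hG, ← hj]; rfl) (by rw [hG, ← hj]; rfl) hg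
  obtain ⟨r, hr'⟩ : ∃ r, r = ept Y 1 ≫ R := ⟨_, rfl⟩
  have hr : j ≫ r = 𝟙 X := by
    rw [hr', ← hG₁, ← hRG, ept_whiskerRight_comp]
  have hrp : r ≫ pX = pY := by
    rw [hr', Category.assoc, hR, ept_fst_comp]
  have h₃ : FibHomotopy pY pY (g ≫ j) (r ≫ j) :=
    ⟨R ≫ j, by rw [← hR₀, Category.assoc], by rw [hr', Category.assoc], by rw [Category.assoc, hj, hR]⟩
  obtain ⟨K, hK₀, hK₁, hK⟩ :=
    ((h₂.fibHomotopy hpY (Category.id_comp _)).symm hpY).trans hpY h₃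
  have hrj : j ≫ r ≫ j = j := by rw [← Category.assoc, hr, Category.id_comp]
  obtain ⟨H, hH₀, hH₁, hH, hHj⟩ := hpY.exists_homotopy_of_common_target j pY K
    ((r ≫ j) ▷ Δ[1] ≫ K) hK
    (by
      rw [Category.assoc, hK]
      rw [whiskerRight_fst_comp, Category.assoc, hj, hrp])
    (by
      rw [ept_whiskerRight_comp, hK₁, Category.assoc, hrj])
    (by
      rw [← Category.assoc, ← comp_whiskerRight, hrj])
  refine ⟨r, H, hr, by rw [hH₀, hK₀], ?_, hH, by rw [hHj, hK₀, Category.comp_id]⟩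
  rw [hH₁]
  rw [ept_whiskerRight_comp, hK₀, Category.comp_id]

end FibHomotopy

/-- An injective simplicial set containing `X`: the simplicial set cofreely generated by the
family of pointed sets `Option (X.obj k)`. -/
def injectiveHull (X : SSet.{0}) : SSet.{0} where
  obj n := ∀ k : SimplexCategory, (k ⟶ n.unop) → Option (X.obj (Opposite.op k))
  map φ := ↾fun w k θ => w k (θ ≫ φ.unop)

namespace injectiveHull

variable {X : SSet.{0}}

/-- The map to `injectiveHull X` determined by a family of partial functions. -/
def ofFun {L : SSet.{0}} (f : ∀ k, L.obj (Opposite.op k) → Option (X.obj (Opposite.op k))) :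
    L ⟶ injectiveHull X where
  app n := ↾fun l k θ => f k (L.map θ.op l)
  naturality n m φ := by
    ext l
    funext k θ
    change f k (L.map θ.op (L.map φ l)) = f k (L.map (θ ≫ φ.unop).op l)
    rw [op_comp, Functor.map_comp_apply]
    rfl

/-- The partial functions underlying a map to `injectiveHull X`. -/
def toFun {L : SSet.{0}} (f : L ⟶ injectiveHull X) (k : SimplexCategory)
    (l : L.obj (Opposite.op k)) : Option (X.obj (Opposite.op k)) :=
  f.app _ l k (𝟙 k)

theorem toFun_ofFun {L : SSet.{0}}
    (f : ∀ k, L.obj (Opposite.op k) → Option (X.obj (Opposite.op k))) : toFun (ofFun f) = f := by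
  funext k l
  change f k (L.map (𝟙 _) l) = _
  rw [Functor.map_id_apply]

theorem app_eq_toFun {L : SSet.{0}} (f : L ⟶ injectiveHull X) {n : SimplexCategoryᵒᵖ}
    (l : L.obj n) (k : SimplexCategory) (θ : k ⟶ n.unop) :
    f.app n l k θ = toFun f k (L.map θ.op l) := by
  rw [toFun, ← map_app]
  exact (congr_arg (f.app n l k) (Category.id_comp θ)).symm

theorem hom_ext {L : SSet.{0}} {f g : L ⟶ injectiveHull X} (h : toFun f = toFun g) : f = g := by
  ext n l
  funext k θ
  refine (app_eq_toFun f l k θ).trans ?_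
  rw [h]
  exact (app_eq_toFun g l k θ).symm

/-- The embedding of `X` in `injectiveHull X`. -/
def ι (X : SSet.{0}) : X ⟶ injectiveHull X := ofFun fun _ => some

instance : Mono (ι X) := by
  refine ⟨fun f g h => ?_⟩
  ext n x
  have := congr_fun (congr_fun (congr_arg toFun h) n.unop) x
  rw [toFun, toFun] at this
  change some (X.map (𝟙 _) (f.app n x)) = some (X.map (𝟙 _) (g.app n x)) at this
  rw [Functor.map_id_apply, Functor.map_id_apply] at this
  exact Option.some_injective _ this

theorem exists_extension {K L : SSet.{0}} (a : K ⟶ L) [Mono a] (f : K ⟶ injectiveHull X) :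
    ∃ g : L ⟶ injectiveHull X, a ≫ g = f := by
  classical
  let φ : ∀ k, L.obj (Opposite.op k) → Option (X.obj (Opposite.op k)) := fun k l =>
    if h : ∃ x, a.app _ x = l then toFun f k h.choose else none
  refine ⟨ofFun φ, hom_ext ?_⟩
  funext k x
  have h : ∃ y, a.app _ y = a.app _ x := ⟨x, rfl⟩
  refine (congr_fun (congr_fun (toFun_ofFun φ) k) (a.app _ x)).trans ?_
  dsimp only [φ]
  rw [dif_pos h, app_injective a _ h.choose_spec]

theorem exists_homotopy {L : SSet.{0}} (f g : L ⟶ injectiveHull X) :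
    ∃ H : L ⊗ Δ[1] ⟶ injectiveHull X, ept L 0 ≫ H = f ∧ ept L 1 ≫ H = g := by
  classical
  let φ : ∀ k, (L ⊗ Δ[1]).obj (Opposite.op k) → Option (X.obj (Opposite.op k)) := fun k z =>
    if z.2 = stdSimplex.const 1 0 (Opposite.op k) then toFun f k z.1 else toFun g k z.1
  refine ⟨ofFun φ, hom_ext ?_, hom_ext ?_⟩ <;> funext k x
  · exact (congr_fun (congr_fun (toFun_ofFun φ) k) (x, stdSimplex.const 1 0 _)).trans
      (if_pos rfl)
  · exact (congr_fun (congr_fun (toFun_ofFun φ) k) (x, stdSimplex.const 1 1 _)).trans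
      (if_neg (const_zero_ne_const_one _).symm)

end injectiveHull

theorem KanFibration.comp {X Y Z : SSet.{0}} {p : X ⟶ Y} {q : Y ⟶ Z} (hp : KanFibration p)
    (hq : KanFibration q) : KanFibration (p ≫ q) := fun n i =>
  have := hp n i
  have := hq n i
  inferInstance

theorem KanFibration.of_isPullback {X Y A B : SSet.{0}} {f : X ⟶ Y} {p : X ⟶ A} {q : Y ⟶ B}
    {g : A ⟶ B} (h : IsPullback f p q g) (hq : KanFibration q) : KanFibration p := fun n i =>
  have := hq n i
  h.hasLiftingProperty _

theorem KanFibration.of_retract {X Y B : SSet.{0}} {q : X ⟶ B} {p : Y ⟶ B} (i : X ⟶ Y)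
    (r : Y ⟶ X) (hir : i ≫ r = 𝟙 X) (hi : i ≫ p = q) (hr : r ≫ q = p) (hp : KanFibration p) :
    KanFibration q := fun n k =>
  have := hp n k
  have h : RetractArrow q p :=
    { i := Arrow.homMk (f := Arrow.mk q) (g := Arrow.mk p) i (𝟙 B) (by simpa using hi)
      r := Arrow.homMk (f := Arrow.mk p) (g := Arrow.mk q) r (𝟙 B) (by simpa using hr)
      retract := by ext <;> simp [hir] }
  h.rightLiftingProperty _

theorem kanFibration_fst_injectiveHull (X Y : SSet.{0}) :
    KanFibration (SemiCartesianMonoidalCategory.fst Y (injectiveHull X)) := by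
  refine fun n i => ⟨fun {f g} sq => ?_⟩
  obtain ⟨h, hh⟩ := injectiveHull.exists_extension (SSet.horn (n + 1) i).ι
    (f ≫ SemiCartesianMonoidalCategory.snd _ _)
  exact ⟨⟨{
    l := CartesianMonoidalCategory.lift g h
    fac_left := by
      apply CartesianMonoidalCategory.hom_ext
      · simp [sq.w]
      · simp [hh]
    fac_right := by simp }⟩⟩

theorem FibHomotopy.of_comp_fst_eq {X Y L B : SSet.{0}} (pY : Y ⟶ B) {pL : L ⟶ B}
    {f g : L ⟶ Y ⊗ injectiveHull X}
    (hf : f ≫ SemiCartesianMonoidalCategory.fst _ _ ≫ pY = pL)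
    (h : f ≫ SemiCartesianMonoidalCategory.fst _ _ = g ≫ SemiCartesianMonoidalCategory.fst _ _) :
    FibHomotopy pL (SemiCartesianMonoidalCategory.fst Y (injectiveHull X) ≫ pY) f g := by
  obtain ⟨H, hH₀, hH₁⟩ := injectiveHull.exists_homotopy
    (f ≫ SemiCartesianMonoidalCategory.snd _ _) (g ≫ SemiCartesianMonoidalCategory.snd _ _)
  refine ⟨CartesianMonoidalCategory.lift (SemiCartesianMonoidalCategory.fst L Δ[1] ≫ f ≫
    SemiCartesianMonoidalCategory.fst _ _) H, ?_, ?_, ?_⟩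
  · rw [CartesianMonoidalCategory.comp_lift, hH₀, ept_fst_comp,
      CartesianMonoidalCategory.lift_comp_fst_snd]
  · rw [CartesianMonoidalCategory.comp_lift, hH₁, ept_fst_comp, h,
      CartesianMonoidalCategory.lift_comp_fst_snd]
  · rw [← Category.assoc, CartesianMonoidalCategory.lift_fst]
    simp only [Category.assoc, hf]

theorem fibHomotopyEquivalence_fst_injectiveHull (X : SSet.{0}) {Y B : SSet.{0}} (pY : Y ⟶ B) :
    FibHomotopyEquivalence (SemiCartesianMonoidalCategory.fst Y (injectiveHull X) ≫ pY) pY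
      (SemiCartesianMonoidalCategory.fst _ _) := by
  refine ⟨rfl, CartesianMonoidalCategory.lift (𝟙 Y) (injectiveHull.ofFun fun _ _ => none),
    by simp, .rel _ _ (.of_comp_fst_eq pY (by simp) (by simp)), ?_⟩
  rw [CartesianMonoidalCategory.lift_fst]
  exact .refl _

/-- Lifting a fiberwise homotopy equivalence along the projection from a product with an
injective simplicial set. -/
theorem FibHomotopyEquivalence.lift_injectiveHull {X Y X' A : SSet.{0}} {pX : X ⟶ A} {pY : Y ⟶ A}
    {w : X ⟶ Y} (hw : FibHomotopyEquivalence pX pY w) (f : X ⟶ injectiveHull X') :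
    FibHomotopyEquivalence pX (SemiCartesianMonoidalCategory.fst Y (injectiveHull X') ≫ pY)
      (CartesianMonoidalCategory.lift w f) := by
  obtain ⟨hw, g, hg, h₁, h₂⟩ := hw
  refine ⟨by simp [hw], SemiCartesianMonoidalCategory.fst _ _ ≫ g, by simp [hg],
    by simpa using h₁, ?_⟩
  let s : Y ⟶ Y ⊗ injectiveHull X' :=
    CartesianMonoidalCategory.lift (𝟙 Y) (injectiveHull.ofFun fun _ _ => none)
  refine .trans _ (SemiCartesianMonoidalCategory.fst _ _ ≫ (g ≫ w) ≫ s) _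
    (.rel _ _ (.of_comp_fst_eq pY (by simp [hg, hw]) (by simp [s]))) ?_
  refine .trans _ (SemiCartesianMonoidalCategory.fst _ _ ≫ 𝟙 Y ≫ s) _ ?_
    (.rel _ _ (.of_comp_fst_eq pY (by simp [s]) (by simp [s])))
  exact (h₂.comp_right s (by simp [s])).comp_left (SemiCartesianMonoidalCategory.fst _ _) rfl

/-- The part of `Z` whose intersection with the image of a map `m : E ⟶ Z` comes from the image
of `j : X ⟶ E`. -/
def replacedSubcomplex {X E Z : SSet.{0}} (j : X ⟶ E) (m : E ⟶ Z) : Z.Subcomplex where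
  obj n := {z | ∀ n' (φ : n ⟶ n') (e : E.obj n'), m.app _ e = Z.map φ z →
    e ∈ Set.range (j.app n')}
  map {n n'} φ z hz n'' φ' e he := hz n'' (φ ≫ φ') e (by rw [he, Functor.map_comp_apply])

/-- A fibrant subobject of `E` over `A` which is fiberwise homotopy equivalent to `E` extends to
such a subobject of any fibrant object over `B` which restricts to `E`. -/
theorem exists_extension_of_isPullback {A B E X Z : SSet.{0}} {i : A ⟶ B} {m : E ⟶ Z}
    {pE : E ⟶ A} {pZ : Z ⟶ B} {pX : X ⟶ A} [Mono i] (sq : IsPullback m pE pZ i)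
    (hpZ : KanFibration pZ) (hpX : KanFibration pX) {j : X ⟶ E} [Mono j]
    (hj : FibHomotopyEquivalence pX pE j) :
    ∃ (Y : SSet.{0}) (k : Y ⟶ Z) (n : X ⟶ Y), KanFibration (k ≫ pZ) ∧
      FibHomotopyEquivalence (k ≫ pZ) pZ k ∧ n ≫ k = j ≫ m ∧ IsPullback n pX (k ≫ pZ) i := by
  obtain ⟨r, H, -, hH₀, hH₁, hH, hHj⟩ :=
    hj.exists_strong_deformation_retraction hpX (hpZ.of_isPullback sq)
  have hjp := hj.1
  have : Mono m := ⟨fun f g h => sq.hom_ext h (by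
    rw [← cancel_mono i, Category.assoc, Category.assoc, ← sq.w, ← Category.assoc, h,
      Category.assoc])⟩
  let Q := replacedSubcomplex j m
  have hQ : ∀ n (e : E.obj n), m.app n e ∈ Q.obj n → e ∈ Set.range (j.app n) := fun n e h =>
    h n (𝟙 n) e (by rw [Functor.map_id_apply])
  have hQ' : ∀ n (x : X.obj n), m.app n (j.app n x) ∈ Q.obj n := by
    intro n x n' φ e he
    rw [map_app, map_app] at he
    exact ⟨X.map φ x, (app_injective m _ he).symm⟩
  obtain ⟨H', hH'₀, hH'm, hH'Q, hH'⟩ := hpZ.exists_homotopy_lift 0 m Q.ι (H ≫ m)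
    (SemiCartesianMonoidalCategory.fst _ Δ[1] ≫ Q.ι) (𝟙 Z)
    (SemiCartesianMonoidalCategory.fst _ Δ[1] ≫ pZ)
    (by
      rintro n x ⟨y, hy⟩ t (rfl : _ = y)
      obtain ⟨x, rfl⟩ := hQ n x hy
      exact congr_arg (m.app n) (app_congr hHj (x, t)))
    (by rw [← Category.assoc, hH₀, Category.id_comp, Category.comp_id])
    (by rw [ept_fst_comp, Category.comp_id])
    (by rw [whiskerRight_fst_comp, Category.assoc, sq.w, ← Category.assoc, hH, Category.assoc])
    (by rw [whiskerRight_fst_comp, Category.assoc])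
    (by rw [ept_fst_comp, Category.id_comp])
  obtain ⟨φ, hφ⟩ : ∃ φ, φ = ept Z 1 ≫ H' := ⟨_, rfl⟩
  have hφp : φ ≫ pZ = pZ := by rw [hφ, Category.assoc, hH', ept_fst_comp]
  have hφm : m ≫ φ = r ≫ j ≫ m := by
    rw [hφ, ← ept_whiskerRight_comp, hH'm, ← Category.assoc, hH₁, Category.assoc]
  have hφQ : Subcomplex.range φ ≤ Q := by
    rintro n _ ⟨z, rfl⟩ n' θ e he
    rw [map_app] at he
    obtain ⟨e', he', -⟩ : ∃ e', m.app n' e' = Z.map θ z ∧ pE.app n' e' = pE.app n' e :=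
      Types.exists_of_isPullback (sq.map ((evaluation _ _).obj n')) _ _ (by
        have h₁ := app_congr hφp (Z.map θ z)
        have h₂ := app_congr sq.w e
        exact h₁.symm.trans ((congr_arg (pZ.app n') he.symm).trans h₂))
    refine ⟨r.app n' e', app_injective m _ ?_⟩
    rw [he, ← he']
    exact (app_congr hφm e').symm
  let ρ : Z ⟶ Q := Subcomplex.lift φ hφQ
  have hρ : ρ ≫ Q.ι = φ := Subcomplex.lift_ι _ _
  have hιρ : Q.ι ≫ ρ = 𝟙 _ := by
    rw [← cancel_mono Q.ι, Category.assoc, hρ, hφ, ← ept_whiskerRight_comp, hH'Q, ept_fst_comp,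
      Category.id_comp]
  let n : X ⟶ Q := Subcomplex.lift (j ≫ m) (by rintro k _ ⟨x, rfl⟩; exact hQ' k x)
  have hn : n ≫ Q.ι = j ≫ m := Subcomplex.lift_ι _ _
  have hρp : ρ ≫ Q.ι ≫ pZ = pZ := by rw [← Category.assoc, hρ, hφp]
  refine ⟨Q, Q.ι, n, hpZ.of_retract Q.ι ρ hιρ rfl hρp, ⟨rfl, ρ, hρp, ?_, ?_⟩, hn, ?_⟩
  · rw [hιρ]
    exact .refl _
  · rw [hρ]
    exact .symm _ _ (.rel _ _ ⟨H', hH'₀, hφ.symm, hH'⟩)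
  · have hw : n ≫ Q.ι ≫ pZ = pX ≫ i := by
      rw [← Category.assoc, hn, Category.assoc, sq.w, ← hjp, Category.assoc]
    have : Mono n := by
      have : Mono (n ≫ Q.ι) := by rw [hn]; infer_instance
      exact mono_of_mono n Q.ι
    have key : ∀ s : PullbackCone (Q.ι ≫ pZ) i, ∃ l : s.pt ⟶ X, l ≫ n = s.fst := by
      intro s
      let t : s.pt ⟶ E := sq.lift (s.fst ≫ Q.ι) s.snd (by rw [Category.assoc, s.condition])
      have ht : t ≫ m = s.fst ≫ Q.ι := sq.lift_fst _ _ _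
      have htj : Subcomplex.range t ≤ Subcomplex.range j := by
        rintro k _ ⟨x, rfl⟩
        refine hQ k _ ?_
        rw [show m.app k (t.app k x) = (s.fst.app k x).1 from app_congr ht x]
        exact (s.fst.app k x).2
      have : Mono (Subcomplex.toRange j) :=
        mono_of_mono_fac (Subcomplex.toRange_ι j)
      have := isIso_of_mono_of_epi (Subcomplex.toRange j)
      refine ⟨Subcomplex.lift t htj ≫ inv (Subcomplex.toRange j), ?_⟩
      rw [← cancel_mono Q.ι, Category.assoc, Category.assoc, hn, ← ht]
      have htr : inv (Subcomplex.toRange j) ≫ j = (Subcomplex.range j).ι := by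
        rw [IsIso.inv_comp_eq, Subcomplex.toRange_ι]
      rw [← Category.assoc (inv _), htr, ← Category.assoc, Subcomplex.lift_ι]
    choose l hl using key
    refine ⟨⟨hw⟩, ⟨PullbackCone.IsLimit.mk _ l hl (fun s => ?_) (fun s a ha _ => ?_)⟩⟩
    · rw [← cancel_mono i, Category.assoc, ← hw, ← Category.assoc, hl, s.condition]
    · rw [← cancel_mono n, ha, hl]

theorem isPullback_whiskerRight_fst {A B Y X : SSet.{0}} {i : A ⟶ B} {f : X ⟶ Y} {p : X ⟶ A}
    {q : Y ⟶ B} (h : IsPullback f p q i) (W : SSet.{0}) :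
    IsPullback (f ▷ W) (SemiCartesianMonoidalCategory.fst _ W ≫ p)
      (SemiCartesianMonoidalCategory.fst Y W ≫ q) i := by
  refine ⟨⟨by simp [h.w]⟩, ⟨PullbackCone.IsLimit.mk _ (fun s => CartesianMonoidalCategory.lift
    (h.lift (s.fst ≫ SemiCartesianMonoidalCategory.fst _ _) s.snd ?_)
    (s.fst ≫ SemiCartesianMonoidalCategory.snd _ _)) ?_ ?_ ?_⟩⟩
  · rw [← s.condition, Category.assoc]
  · intro s
    apply CartesianMonoidalCategory.hom_ext <;> simp
  · intro s
    simp
  · intro s a h₁ h₂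
    apply CartesianMonoidalCategory.hom_ext
    · apply h.hom_ext
      · simp [← h₁]
      · simpa using h₂
    · simp [← h₁]

end Paper
/-- Equivalence extension property. -/
theorem equivalence_extension {A B Y₁ X₀ : SSet.{0}} (i : A ⟶ B) (hi : Mono i)
    (q₁ : Y₁ ⟶ B) (hq₁ : Paper.KanFibration q₁)
    (p₀ : X₀ ⟶ A) (hp₀ : Paper.KanFibration p₀)
    (w : X₀ ⟶ pullback i q₁)
    (hw : Paper.FibHomotopyEquivalence p₀ (pullback.fst i q₁) w) :
    ∃ (Y₀ : SSet.{0}) (q₀ : Y₀ ⟶ B) (v : Y₀ ⟶ Y₁) (hv : v ≫ q₁ = q₀),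
      Paper.KanFibration q₀ ∧
      Paper.FibHomotopyEquivalence q₀ q₁ v ∧
      ∃ e : X₀ ≅ pullback i q₀,
        e.hom ≫ pullback.fst i q₀ = p₀ ∧
        e.hom ≫ pullback.map i q₀ i q₁ (𝟙 A) v (𝟙 B)
            (by rw [Category.comp_id, Category.id_comp])
            (by rw [Category.comp_id, hv]) = w := by
  have sq := Paper.isPullback_whiskerRight_fst (IsPullback.of_hasPullback i q₁).flip
    (Paper.injectiveHull X₀)
  have hη : Mono (CartesianMonoidalCategory.lift w (Paper.injectiveHull.ι X₀)) :=
    mono_of_mono_fac (CartesianMonoidalCategory.lift_snd _ _)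
  obtain ⟨Y₀, k, n, hk, hkf, hnk, hn⟩ := Paper.exists_extension_of_isPullback sq
    ((Paper.kanFibration_fst_injectiveHull X₀ Y₁).comp hq₁) hp₀
    (hw.lift_injectiveHull (Paper.injectiveHull.ι X₀))
  refine ⟨Y₀, _, k ≫ SemiCartesianMonoidalCategory.fst _ _, Category.assoc _ _ _, hk,
    hkf.comp (Paper.fibHomotopyEquivalence_fst_injectiveHull X₀ q₁), hn.flip.isoPullback,
    hn.flip.isoPullback_hom_fst, ?_⟩
  apply pullback.hom_ext
  · rw [Category.assoc, pullback.lift_fst, Category.comp_id, hn.flip.isoPullback_hom_fst, hw.1]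
  · rw [Category.assoc, pullback.lift_snd, ← Category.assoc, hn.flip.isoPullback_hom_snd,
      ← Category.assoc, hnk, Category.assoc, CartesianMonoidalCategory.whiskerRight_fst,
      ← Category.assoc, CartesianMonoidalCategory.lift_fst]
end
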